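/- Let k > 0 and let C_T = {τ ∈ M³ˣ³_sym : λ₁(τ) − λ₃(τ) ≤ 2k} be the Tresca yield domain. Let σ ∈ M³ˣ³_sym with λ₁(σ) − λ₃(σ) = 2k and λ₁(σ) > λ₂(σ) > λ₃(σ), let v₁ and v₃ be unit eigenvectors of σ for λ₁(σ) and λ₃(σ), and set g = v₁v₁ᵀ − v₃v₃ᵀ. Let λ > 0, μ > 0, H(τ) = 2μτ + λ tr(τ)I. Then for every ε̇ ∈ M³ˣ³_sym: P_{N_{C_T}(σ)}(ε̇) = ½ max(0, ε̇:g) · g, P_{T_{C_T}(σ)}(ε̇) = ε̇ − ½ max(0, ε̇:g) · g, and P_{T_{C_T}(σ)}(H(ε̇)) = λ tr(ε̇) I + 2μ(ε̇ − ½ max(0, ε̇:g) · g). -/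

import Mathlib

open Matrix

/-- The space of 3×3 real matrices (we single out the symmetric ones by `Matrix.IsSymm`). -/
abbrev Mat3 := Matrix (Fin 3) (Fin 3) ℝ

/-- The Frobenius inner product on symmetric matrices: `σ:τ = tr(στ)`. -/
noncomputable def minner (A B : Mat3) : ℝ := (A * B).trace

/-- The Frobenius norm `‖A‖ = (A:A)^{1/2}` on symmetric matrices. -/
noncomputable def mnorm (A : Mat3) : ℝ := Real.sqrt (minner A A)

/-- `p` is the metric (orthogonal) projection of `z` onto `K`. -/
def IsProjOn (K : Set Mat3) (z p : Mat3) : Prop :=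
  p ∈ K ∧ ∀ w ∈ K, mnorm (z - p) ≤ mnorm (z - w)

/-- The tangent cone of a convex set `C` at `σ`. -/
def tangentCone (C : Set Mat3) (σ : Mat3) : Set Mat3 :=
  closure {τ | ∃ η ∈ C, ∃ α : ℝ, 0 < α ∧ τ = α • (η - σ)}

/-- The normal cone of a convex set `C ⊆ M³ˣ³_sym` at `σ`. -/
def normalCone (C : Set Mat3) (σ : Mat3) : Set Mat3 :=
  {n | n.IsSymm ∧ ∀ τ ∈ tangentCone C σ, minner n τ ≤ 0}

/-- The Hooke (isotropic elasticity) operator `H(τ) = 2μτ + λ tr(τ) I`. -/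
noncomputable def hooke (lam mu : ℝ) (τ : Mat3) : Mat3 :=
  (2 * mu) • τ + (lam * τ.trace) • (1 : Mat3)

/-- The set of (real) eigenvalues of `A`, i.e. the real roots of `det(A - t I) = 0`. -/
def eigSet (A : Mat3) : Set ℝ := {t : ℝ | (A - t • (1 : Mat3)).det = 0}

/-- The largest eigenvalue `λ₁(A)` of `A`. -/
noncomputable def lam1 (A : Mat3) : ℝ := sSup (eigSet A)

/-- The smallest eigenvalue `λ₃(A)` of `A`. -/
noncomputable def lam3 (A : Mat3) : ℝ := sInf (eigSet A)

/-- The middle eigenvalue `λ₂(A)` of `A` (recovered from the trace). -/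
noncomputable def lam2 (A : Mat3) : ℝ := A.trace - lam1 A - lam3 A

lemma spec3 (A : Mat3) (hA : A.IsSymm) : ∃ (U : Mat3) (d : Fin 3 → ℝ),
    U * Uᵀ = 1 ∧ Uᵀ * U = 1 ∧ A = U * diagonal d * Uᵀ := by
  have hH : A.IsHermitian := by
    rw [Matrix.IsHermitian, Matrix.conjTranspose_eq_transpose_of_trivial]; exact hA
  refine ⟨(hH.eigenvectorUnitary : Mat3), hH.eigenvalues, ?_, ?_, ?_⟩
  · have := Unitary.coe_mul_star_self hH.eigenvectorUnitary
    rwa [Unitary.coe_star, Matrix.star_eq_conjTranspose, Matrix.conjTranspose_eq_transpose_of_trivial] at this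
  · have := Unitary.coe_star_mul_self hH.eigenvectorUnitary
    rwa [Matrix.star_eq_conjTranspose, Matrix.conjTranspose_eq_transpose_of_trivial] at this
  · have := hH.spectral_theorem
    rw [Unitary.conjStarAlgAut_apply, Matrix.star_eq_conjTranspose, Matrix.conjTranspose_eq_transpose_of_trivial] at this
    exact this

lemma eigSet_eq (A U : Mat3) (d : Fin 3 → ℝ) (h1 : U * Uᵀ = 1)
    (h : A = U * diagonal d * Uᵀ) : eigSet A = Set.range d := by
  ext t
  have e : A - t • (1 : Mat3) = U * diagonal (fun i => d i - t) * Uᵀ := by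
    have : diagonal (fun i => d i - t) = diagonal d - t • (1 : Mat3) := by
      ext i j; by_cases hij : i = j <;> simp [hij, Matrix.one_apply]
    rw [this, Matrix.mul_sub, Matrix.sub_mul, ← h]
    simp [h1]
  have hd : U.det * Uᵀ.det = 1 := by rw [← det_mul, h1, det_one]
  have e2 : (A - t • (1 : Mat3)).det = ∏ i, (d i - t) := by
    rw [e, det_mul, det_mul, det_diagonal]
    linear_combination (∏ i, (d i - t)) * hd
  simp only [eigSet, Set.mem_setOf_eq, e2, Finset.prod_eq_zero_iff, Set.mem_range, sub_eq_zero]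
  simp

lemma rayleigh (A : Mat3) (hA : A.IsSymm) (u : Fin 3 → ℝ) :
    u ⬝ᵥ A *ᵥ u ≤ lam1 A * (u ⬝ᵥ u) ∧ lam3 A * (u ⬝ᵥ u) ≤ u ⬝ᵥ A *ᵥ u := by
  obtain ⟨U, d, h1, h2, h⟩ := spec3 A hA
  have hS := eigSet_eq A U d h1 h
  have hfin : (eigSet A).Finite := hS ▸ Set.finite_range d
  have e1 : u ⬝ᵥ A *ᵥ u = ∑ i, d i * ((Uᵀ *ᵥ u) i)^2 := by
    have : u ⬝ᵥ A *ᵥ u = (Uᵀ *ᵥ u) ⬝ᵥ diagonal d *ᵥ (Uᵀ *ᵥ u) := by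
      rw [h, ← mulVec_mulVec, ← mulVec_mulVec, dotProduct_mulVec, ← mulVec_transpose]
    rw [this]
    simp only [dotProduct, mulVec_diagonal]
    exact Finset.sum_congr rfl fun i _ => by ring
  have e2 : u ⬝ᵥ u = ∑ i, ((Uᵀ *ᵥ u) i)^2 := by
    have : u ⬝ᵥ u = (Uᵀ *ᵥ u) ⬝ᵥ (Uᵀ *ᵥ u) := by
      have h3 : u ⬝ᵥ (U * Uᵀ) *ᵥ u = (Uᵀ *ᵥ u) ⬝ᵥ (Uᵀ *ᵥ u) := by
        rw [← mulVec_mulVec, dotProduct_mulVec, ← mulVec_transpose]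
      rw [← h3, h1, one_mulVec]
    rw [this]
    simp only [dotProduct]
    exact Finset.sum_congr rfl fun i _ => by ring
  rw [e1, e2, Finset.mul_sum, Finset.mul_sum]
  constructor
  · refine Finset.sum_le_sum fun i _ => mul_le_mul_of_nonneg_right ?_ (sq_nonneg _)
    exact le_csSup hfin.bddAbove (hS ▸ Set.mem_range_self i)
  · refine Finset.sum_le_sum fun i _ => mul_le_mul_of_nonneg_right ?_ (sq_nonneg _)
    exact csInf_le hfin.bddBelow (hS ▸ Set.mem_range_self i)

lemma eig_vec (A : Mat3) (t : ℝ) (ht : t ∈ eigSet A) :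
    ∃ u : Fin 3 → ℝ, 0 < u ⬝ᵥ u ∧ u ⬝ᵥ A *ᵥ u = t * (u ⬝ᵥ u) := by
  obtain ⟨u, hu, h⟩ := Matrix.exists_mulVec_eq_zero_iff.2 ht
  refine ⟨u, ?_, ?_⟩
  · exact lt_of_le_of_ne (Finset.sum_nonneg fun i _ => mul_self_nonneg _)
      (fun h => hu (dotProduct_self_eq_zero.1 h.symm))
  · rw [sub_mulVec, sub_eq_zero, smul_mulVec, one_mulVec] at h
    rw [h, dotProduct_smul, smul_eq_mul]

lemma eigSet_nonempty (A : Mat3) (hA : A.IsSymm) : (eigSet A).Nonempty := by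
  obtain ⟨U, d, h1, h2, h⟩ := spec3 A hA
  rw [eigSet_eq A U d h1 h]; exact Set.range_nonempty d

lemma lam1_le (A : Mat3) (hA : A.IsSymm) (M : ℝ) (h : ∀ u, u ⬝ᵥ A *ᵥ u ≤ M * (u ⬝ᵥ u)) :
    lam1 A ≤ M := by
  refine csSup_le (eigSet_nonempty A hA) fun t ht => ?_
  obtain ⟨u, hu, e⟩ := eig_vec A t ht
  have := h u
  rw [e] at this
  exact le_of_mul_le_mul_right this hu

lemma le_lam3 (A : Mat3) (hA : A.IsSymm) (M : ℝ) (h : ∀ u, M * (u ⬝ᵥ u) ≤ u ⬝ᵥ A *ᵥ u) :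
    M ≤ lam3 A := by
  refine le_csInf (eigSet_nonempty A hA) fun t ht => ?_
  obtain ⟨u, hu, e⟩ := eig_vec A t ht
  have := h u
  rw [e] at this
  exact le_of_mul_le_mul_right this hu

lemma symm_dot (A : Mat3) (hA : A.IsSymm) (u w : Fin 3 → ℝ) :
    u ⬝ᵥ A *ᵥ w = w ⬝ᵥ A *ᵥ u := by
  rw [dotProduct_mulVec, ← mulVec_transpose, hA.eq, dotProduct_comm]

lemma perturb (σ τ : Mat3) (hσ : σ.IsSymm) (hτ : τ.IsSymm) (v : Fin 3 → ℝ) (l d : ℝ)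
    (hd : 0 < d) (hv : σ *ᵥ v = l • v) (hvu : v ⬝ᵥ v = 1)
    (hgap : ∀ y, v ⬝ᵥ y = 0 → y ⬝ᵥ σ *ᵥ y ≤ (l - d) * (y ⬝ᵥ y)) :
    ∃ K t0 : ℝ, 0 ≤ K ∧ 0 < t0 ∧ ∀ t, 0 < t → t ≤ t0 → ∀ u,
      u ⬝ᵥ (σ + t • τ) *ᵥ u ≤ (l + t * (v ⬝ᵥ τ *ᵥ v) + K * t^2) * (u ⬝ᵥ u) := by
  set p := v ⬝ᵥ τ *ᵥ v with hp
  set S := (τ *ᵥ v) ⬝ᵥ (τ *ᵥ v) with hS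
  have hS0 : 0 ≤ S := Finset.sum_nonneg fun i _ => mul_self_nonneg _
  set B := lam1 τ
  have hE : 0 < 2 * (S + 1) / d := by positivity
  refine ⟨2 * (S + 1) / d, d / (2 * (|B - p| + 1)), hE.le, by positivity, ?_⟩
  intro t ht ht0 u
  set E := 2 * (S + 1) / d with hEd
  have hEe : E * d = 2 * (S + 1) := by rw [hEd]; field_simp
  have htB : t * (B - p) ≤ d / 2 := by
    rw [le_div_iff₀ (by positivity)] at ht0
    nlinarith [le_abs_self (B - p)]
  obtain ⟨a, y, hu, hy⟩ : ∃ (a : ℝ) (y : Fin 3 → ℝ), u = a • v + y ∧ v ⬝ᵥ y = 0 := by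
    refine ⟨v ⬝ᵥ u, u - (v ⬝ᵥ u) • v, by simp, ?_⟩
    simp [dotProduct_sub, hvu]
  have hyv : y ⬝ᵥ v = 0 := by rw [dotProduct_comm]; exact hy
  have h1 := hgap y hy
  have h2 := (rayleigh τ hτ y).1
  set n := y ⬝ᵥ y with hn
  have hn0 : 0 ≤ n := Finset.sum_nonneg fun i _ => mul_self_nonneg _
  set s := v ⬝ᵥ τ *ᵥ y with hs
  have hs' : y ⬝ᵥ τ *ᵥ v = s := symm_dot τ hτ _ _
  have hcs : s ^ 2 ≤ S * n := by
    have := Finset.sum_mul_sq_le_sq_mul_sq Finset.univ y (τ *ᵥ v)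
    rw [← hs', hS, hn]
    simp only [dotProduct, ← pow_two]
    linarith
  have hvy : v ⬝ᵥ σ *ᵥ y = 0 := by
    rw [symm_dot σ hσ, hv, dotProduct_smul, hyv, smul_zero]
  have e1 : u ⬝ᵥ u = a^2 + n := by
    rw [hu]; simp [dotProduct_add, add_dotProduct, hvu, hy, hyv, ← hn]; ring
  have e2 : u ⬝ᵥ (σ + t • τ) *ᵥ u = a^2 * l + y ⬝ᵥ σ *ᵥ y
      + t * (a^2 * p + 2 * a * s + y ⬝ᵥ τ *ᵥ y) := by
    rw [hu]
    simp only [add_mulVec, smul_mulVec, mulVec_add, mulVec_smul, dotProduct_add, add_dotProduct,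
      smul_dotProduct, dotProduct_smul, smul_eq_mul, hs', ← hp, ← hs, hvy, hv, hvu, hyv]
    ring
  rw [e1, e2]
  have key : 2 * (a * t) * s ≤ E * (a * t)^2 + d / 2 * n := by
    have h3 : 0 ≤ (E * (a * t) - s)^2 := sq_nonneg _
    have h4 : E * (2 * (a * t) * s) ≤ E * (E * (a * t)^2 + d / 2 * n) := by
      have : E * (d / 2 * n) = (S + 1) * n := by linear_combination n / 2 * hEe
      nlinarith
    exact le_of_mul_le_mul_left h4 hE
  have h5 : t * (y ⬝ᵥ τ *ᵥ y) ≤ t * (B * n) := mul_le_mul_of_nonneg_left h2 ht.le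
  have h6 : t * (B - p) * n ≤ d / 2 * n := mul_le_mul_of_nonneg_right htB hn0
  have h7 : 0 ≤ E * t^2 * n := by positivity
  nlinarith

lemma minner_comm' (A B : Mat3) : minner A B = minner B A := Matrix.trace_mul_comm _ _

lemma minner_vec (A : Mat3) (v : Fin 3 → ℝ) : minner (vecMulVec v v) A = v ⬝ᵥ A *ᵥ v := by
  rw [minner, vecMulVec_mul, trace_vecMulVec, dotProduct_mulVec, dotProduct_comm]

lemma minner_self_nonneg (A : Mat3) (hA : A.IsSymm) : 0 ≤ minner A A := by
  have : minner A A = ∑ i, ∑ j, A i j * A i j := by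
    conv_lhs => rw [minner]; arg 1; arg 2; rw [← hA.eq]
    simp [trace, mul_apply]
  rw [this]
  exact Finset.sum_nonneg fun i _ => Finset.sum_nonneg fun j _ => mul_self_nonneg _

lemma proj_ineq (z p w : Mat3) (hs : (p - w).IsSymm) (h : minner (z - p) (w - p) ≤ 0) :
    mnorm (z - p) ≤ mnorm (z - w) := by
  apply Real.sqrt_le_sqrt
  have h1 := minner_self_nonneg _ hs
  have e : z - w = (z - p) + (p - w) := by abel
  have e2 : minner (z - w) (z - w) = minner (z - p) (z - p) - 2 * minner (z - p) (w - p)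
      + minner (p - w) (p - w) := by
    have h3 := minner_comm' (z - p) (p - w)
    have h4 : minner (z - p) (w - p) = - minner (z - p) (p - w) := by
      rw [← neg_sub p w]; simp only [minner, mul_neg, trace_neg]
    rw [h4, e]
    simp only [minner, add_mul, mul_add, trace_add] at *
    linarith
  linarith

lemma minner_add_right (A B D : Mat3) : minner A (B + D) = minner A B + minner A D := by
  simp [minner, mul_add]
lemma minner_sub_right (A B D : Mat3) : minner A (B - D) = minner A B - minner A D := by
  simp [minner, mul_sub]
lemma minner_smul_right (A B : Mat3) (c : ℝ) : minner A (c • B) = c * minner A B := by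
  simp [minner]
lemma minner_sub_left (A B D : Mat3) : minner (A - B) D = minner A D - minner B D := by
  simp [minner, sub_mul]
lemma minner_smul_left (A B : Mat3) (c : ℝ) : minner (c • A) B = c * minner A B := by
  simp [minner]

lemma gaps (σ : Mat3) (hσ : σ.IsSymm) (a c : ℝ) (v w : Fin 3 → ℝ) (hac : a ≠ c)
    (hv : σ *ᵥ v = a • v) (hvu : v ⬝ᵥ v = 1) (hw : σ *ᵥ w = c • w) (hwu : w ⬝ᵥ w = 1) :
    v ⬝ᵥ w = 0 ∧ ∃ x : Fin 3 → ℝ, ∀ y, y ⬝ᵥ y = (v ⬝ᵥ y)^2 + (x ⬝ᵥ y)^2 + (w ⬝ᵥ y)^2 ∧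
      y ⬝ᵥ σ *ᵥ y = a * (v ⬝ᵥ y)^2 + (σ.trace - a - c) * (x ⬝ᵥ y)^2 + c * (w ⬝ᵥ y)^2 := by
  have hvw : v ⬝ᵥ w = 0 := by
    have h := symm_dot σ hσ v w
    rw [hv, hw, dotProduct_smul, dotProduct_smul, dotProduct_comm w v, smul_eq_mul, smul_eq_mul] at h
    have : (a - c) * (v ⬝ᵥ w) = 0 := by linarith
    exact (mul_eq_zero.1 this).resolve_left (sub_ne_zero.2 hac)
  refine ⟨hvw, v ⨯₃ w, ?_⟩
  set x := v ⨯₃ w with hx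
  have hvx : v ⬝ᵥ x = 0 := dot_self_cross v w
  have hwx : w ⬝ᵥ x = 0 := dot_cross_self v w
  have hxx : x ⬝ᵥ x = 1 := by
    rw [hx, cross_dot_cross, hvu, hwu, hvw]; simp
  set P : Mat3 := Matrix.of ![v, x, w] with hP
  have p0 : P 0 = v := rfl
  have p1 : P 1 = x := rfl
  have p2 : P 2 = w := rfl
  have hPP : P * Pᵀ = 1 := by
    have e : ∀ i j, (P * Pᵀ) i j = P i ⬝ᵥ P j := fun i j => rfl
    ext i j
    rw [e]
    fin_cases i <;> fin_cases j <;>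
      simp [p0, p1, p2, hvu, hwu, hxx, hvx, hwx, hvw, dotProduct_comm x v, dotProduct_comm x w,
        dotProduct_comm w v]
  have hPP' : Pᵀ * P = 1 := mul_eq_one_comm.1 hPP
  have hxv : x ⬝ᵥ σ *ᵥ v = 0 := by rw [hv, dotProduct_smul, dotProduct_comm, hvx, smul_zero]
  have hxw : x ⬝ᵥ σ *ᵥ w = 0 := by rw [hw, dotProduct_smul, dotProduct_comm, hwx, smul_zero]
  have hvx' : v ⬝ᵥ σ *ᵥ x = 0 := by rw [symm_dot σ hσ, hxv]
  have hwx' : w ⬝ᵥ σ *ᵥ x = 0 := by rw [symm_dot σ hσ, hxw]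
  have hD : ∀ i j, (P * σ * Pᵀ) i j = P i ⬝ᵥ σ *ᵥ P j := by
    intro i j
    rw [mul_assoc]; rfl
  have htr : x ⬝ᵥ σ *ᵥ x = σ.trace - a - c := by
    have : (P * σ * Pᵀ).trace = σ.trace := by
      rw [trace_mul_comm, ← mul_assoc, hPP', one_mul]
    rw [trace, Fin.sum_univ_three] at this
    simp only [diag, hD] at this
    simp only [p0, p1, p2, hv, hw, hvu, hwu, dotProduct_smul, smul_eq_mul] at this
    linarith
  intro y
  have hy : y = (v ⬝ᵥ y) • v + (x ⬝ᵥ y) • x + (w ⬝ᵥ y) • w := by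
    have : y = Pᵀ *ᵥ (P *ᵥ y) := by rw [mulVec_mulVec, hPP', one_mulVec]
    conv_lhs => rw [this]
    ext i
    have e : (P *ᵥ y) = ![v ⬝ᵥ y, x ⬝ᵥ y, w ⬝ᵥ y] := by
      ext j; fin_cases j <;> rfl
    rw [e]
    simp [mulVec, dotProduct, Fin.sum_univ_three, hP]
    ring
  generalize v ⬝ᵥ y = α at hy ⊢
  generalize x ⬝ᵥ y = β at hy ⊢
  generalize w ⬝ᵥ y = γ at hy ⊢
  have hwv : w ⬝ᵥ v = 0 := by rw [dotProduct_comm, hvw]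
  have hxv2 : x ⬝ᵥ v = 0 := by rw [dotProduct_comm, hvx]
  have hxw2 : x ⬝ᵥ w = 0 := by rw [dotProduct_comm, hwx]
  constructor
  · rw [hy]
    simp only [dotProduct_add, add_dotProduct,
      smul_dotProduct, dotProduct_smul, smul_eq_mul, hvu, hwu, hxx, hvx, hwx, hvw, hwv, hxv2, hxw2]
    ring
  · rw [hy]
    simp only [mulVec_add, mulVec_smul, dotProduct_add, add_dotProduct,
      smul_dotProduct, dotProduct_smul, smul_eq_mul, hvx', hwx', htr, hv, hw, hvu, hwu, hvw, hwv, hxv2, hxw2]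
    ring

lemma tangent_char (k : ℝ)
    (C : Set Mat3) (hC : C = {τ : Mat3 | τ.IsSymm ∧ lam1 τ - lam3 τ ≤ 2 * k})
    (σ : Mat3) (hσsym : σ.IsSymm) (hσbd : lam1 σ - lam3 σ = 2 * k)
    (h12 : lam2 σ < lam1 σ) (h23 : lam3 σ < lam2 σ)
    (v₁ v₃ : Fin 3 → ℝ)
    (hv₁ : σ *ᵥ v₁ = lam1 σ • v₁) (hv₁u : v₁ ⬝ᵥ v₁ = 1)
    (hv₃ : σ *ᵥ v₃ = lam3 σ • v₃) (hv₃u : v₃ ⬝ᵥ v₃ = 1)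
    (g : Mat3) (hg : g = vecMulVec v₁ v₁ - vecMulVec v₃ v₃) (hgs : g.IsSymm)
    (hgg : minner g g = 2) :
    tangentCone C σ = {τ | τ.IsSymm ∧ minner g τ ≤ 0} := by
  have hgt : ∀ τ, minner g τ = v₁ ⬝ᵥ τ *ᵥ v₁ - v₃ ⬝ᵥ τ *ᵥ v₃ := fun τ => by
    rw [hg, minner_sub_left, minner_vec, minner_vec]
  apply Set.Subset.antisymm
  · apply closure_minimal
    · rintro τ ⟨η, hη, α, hα, rfl⟩
      rw [hC] at hη
      refine ⟨(hη.1.sub hσsym).smul α, ?_⟩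
      rw [minner_smul_right, minner_sub_right]
      have h1 := (rayleigh η hη.1 v₁).1
      have h2 := (rayleigh η hη.1 v₃).2
      have h3 := hη.2
      have : minner g η - minner g σ ≤ 0 := by
        rw [hgt, hgt, hv₁, hv₃, dotProduct_smul, dotProduct_smul]
        simp only [hv₁u, hv₃u, smul_eq_mul] at *
        linarith
      exact mul_nonpos_of_nonneg_of_nonpos hα.le this
    · have hc : Continuous fun τ : Mat3 => minner g τ := by
        unfold minner; fun_prop
      exact (isClosed_eq (by fun_prop) continuous_id).inter (isClosed_le hc continuous_const)
  · have strict : ∀ τ : Mat3, τ.IsSymm → minner g τ < 0 →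
        τ ∈ {τ | ∃ η ∈ C, ∃ α : ℝ, 0 < α ∧ τ = α • (η - σ)} := by
      intro τ hτ hneg
      obtain ⟨hvw, x, hx⟩ := gaps σ hσsym _ _ v₁ v₃ (by linarith) hv₁ hv₁u hv₃ hv₃u
      have hx2 : σ.trace - lam1 σ - lam3 σ = lam2 σ := rfl
      rw [hx2] at hx
      obtain ⟨K, t0, hK, ht0, H⟩ := perturb σ τ hσsym hτ v₁ (lam1 σ) (lam1 σ - lam2 σ)
        (by linarith) hv₁ hv₁u (by
          intro y hy
          obtain ⟨e1, e2⟩ := hx y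
          rw [e2, e1, hy]
          nlinarith [sq_nonneg (v₃ ⬝ᵥ y)])
      obtain ⟨K', t0', hK', ht0', H'⟩ := perturb (-σ) (-τ) hσsym.neg hτ.neg v₃ (-lam3 σ)
        (lam2 σ - lam3 σ)
        (by linarith) (by rw [neg_mulVec, hv₃, neg_smul]) hv₃u (by
          intro y hy
          obtain ⟨e1, e2⟩ := hx y
          rw [neg_mulVec, dotProduct_neg, e2, e1, hy]
          nlinarith [sq_nonneg (v₁ ⬝ᵥ y)])
      set m := - minner g τ with hm
      have hm0 : 0 < m := by linarith
      set t := min (min t0 t0') (m / (K + K' + 1)) with ht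
      have htpos : 0 < t := by
        refine lt_min (lt_min ht0 ht0') (by positivity)
      have ht1 : t ≤ t0 := (min_le_left _ _).trans (min_le_left _ _)
      have ht2 : t ≤ t0' := (min_le_left _ _).trans (min_le_right _ _)
      have ht3 : t * (K + K' + 1) ≤ m := by
        rw [← le_div_iff₀ (by positivity)]; exact min_le_right _ _
      have hsy : (σ + t • τ).IsSymm := hσsym.add (hτ.smul t)
      have L1 := lam1_le _ hsy _ (H t htpos ht1)
      have L3 : lam3 σ + t * (v₃ ⬝ᵥ τ *ᵥ v₃) - K' * t^2 ≤ lam3 (σ + t • τ) := by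
        apply le_lam3 _ hsy
        intro u
        have := H' t htpos ht2 u
        have e : -σ + t • -τ = -(σ + t • τ) := by rw [smul_neg]; abel
        rw [e] at this
        simp only [neg_mulVec, dotProduct_neg] at this
        linarith
      refine ⟨σ + t • τ, ?_, t⁻¹, inv_pos.2 htpos, ?_⟩
      · rw [hC]
        refine ⟨hsy, ?_⟩
        have := hgt τ
        nlinarith
      · rw [add_sub_cancel_left, smul_smul, inv_mul_cancel₀ htpos.ne', one_smul]
    rintro τ ⟨hτ, hle⟩
    have hlim : Filter.Tendsto (fun δ : ℝ => τ - δ • g) (nhdsWithin 0 (Set.Ioi 0)) (nhds τ) := by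
      have : Continuous fun δ : ℝ => τ - δ • g := by fun_prop
      have h := this.tendsto 0
      simp only [zero_smul, sub_zero] at h
      exact h.mono_left nhdsWithin_le_nhds
    refine mem_closure_of_tendsto hlim ?_
    filter_upwards [self_mem_nhdsWithin] with δ hδ
    apply strict _ (hτ.sub (hgs.smul δ))
    rw [minner_sub_right, minner_smul_right, hgg]
    have : 0 < δ := hδ
    linarith

/-- Tresca criterion at a regular boundary point (three distinct principal stresses):
explicit projections onto the normal and tangent cones and the constitutive law,
with `g = v₁v₁ᵀ - v₃v₃ᵀ`. -/
theorem stmt15 (k : ℝ) (hk : 0 < k)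
    (C : Set Mat3) (hC : C = {τ : Mat3 | τ.IsSymm ∧ lam1 τ - lam3 τ ≤ 2 * k})
    (σ : Mat3) (hσsym : σ.IsSymm) (hσbd : lam1 σ - lam3 σ = 2 * k)
    (h12 : lam2 σ < lam1 σ) (h23 : lam3 σ < lam2 σ)
    (v₁ v₃ : Fin 3 → ℝ)
    (hv₁ : σ *ᵥ v₁ = lam1 σ • v₁) (hv₁u : v₁ ⬝ᵥ v₁ = 1)
    (hv₃ : σ *ᵥ v₃ = lam3 σ • v₃) (hv₃u : v₃ ⬝ᵥ v₃ = 1)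
    (g : Mat3) (hg : g = vecMulVec v₁ v₁ - vecMulVec v₃ v₃)
    (lam mu : ℝ) (hlam : 0 < lam) (hmu : 0 < mu) :
    ∀ ε' : Mat3, ε'.IsSymm →
      IsProjOn (normalCone C σ) ε' ((max 0 (minner ε' g) / 2) • g) ∧
      IsProjOn (tangentCone C σ) ε' (ε' - (max 0 (minner ε' g) / 2) • g) ∧
      IsProjOn (tangentCone C σ) (hooke lam mu ε')
        ((lam * ε'.trace) • (1 : Mat3) +
          (2 * mu) • (ε' - (max 0 (minner ε' g) / 2) • g)) := by
  intro ε' hε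
  have hne : lam1 σ ≠ lam3 σ := by linarith
  obtain ⟨hvw, -⟩ := gaps σ hσsym _ _ v₁ v₃ hne hv₁ hv₁u hv₃ hv₃u
  have hgs : g.IsSymm := by
    rw [hg]
    exact Matrix.IsSymm.sub (Matrix.transpose_vecMulVec _ _) (Matrix.transpose_vecMulVec _ _)
  have hvw' : v₃ ⬝ᵥ v₁ = 0 := by rw [dotProduct_comm, hvw]
  have hgg : minner g g = 2 := by
    conv_lhs => rw [hg, minner_sub_left, minner_vec, minner_vec]
    simp only [sub_mulVec, vecMulVec_mulVec, dotProduct_sub, dotProduct_smul, hv₁u, hv₃u, hvw, hvw']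
    norm_num
  have hg1 : minner g 1 = 0 := by
    rw [hg, minner_sub_left, minner_vec, minner_vec, one_mulVec, one_mulVec, hv₁u, hv₃u, sub_self]
  have hT := tangent_char k C hC σ hσsym hσbd h12 h23 v₁ v₃ hv₁ hv₁u hv₃ hv₃u g hg hgs hgg
  have memT : ∀ z : Mat3, z.IsSymm → z - (max 0 (minner z g) / 2) • g ∈ tangentCone C σ := by
    intro z hz
    rw [hT]
    refine ⟨hz.sub (hgs.smul _), ?_⟩
    rw [minner_sub_right, minner_smul_right, hgg, minner_comm' g z]
    linarith [le_max_right 0 (minner z g)]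
  have orth : ∀ z : Mat3, max 0 (minner z g) / 2 *
      minner g (z - (max 0 (minner z g) / 2) • g) = 0 := by
    intro z
    rw [minner_sub_right, minner_smul_right, hgg, minner_comm' g z]
    rcases le_total 0 (minner z g) with h | h
    · rw [max_eq_right h]; ring
    · rw [max_eq_left h]; ring
  have hm : ∀ z : Mat3, 0 ≤ max 0 (minner z g) / 2 := fun z =>
    div_nonneg (le_max_left _ _) (by norm_num)
  have projT : ∀ z : Mat3, z.IsSymm →
      IsProjOn (tangentCone C σ) z (z - (max 0 (minner z g) / 2) • g) := by
    intro z hz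
    refine ⟨memT z hz, fun w hw => ?_⟩
    rw [hT] at hw
    apply proj_ineq _ _ _ ((hz.sub (hgs.smul _)).sub hw.1)
    rw [sub_sub_cancel, minner_smul_left, minner_sub_right, mul_sub, orth, sub_zero]
    exact mul_nonpos_of_nonneg_of_nonpos (hm z) hw.2
  refine ⟨⟨⟨hgs.smul _, ?_⟩, ?_⟩, projT ε' hε, ?_⟩
  · intro τ hτ
    rw [hT] at hτ
    rw [minner_smul_left]
    exact mul_nonpos_of_nonneg_of_nonpos (hm ε') hτ.2
  · intro w hw
    apply proj_ineq _ _ _ ((hgs.smul _).sub hw.1)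
    have h1 := hw.2 _ (memT ε' hε)
    have h2 := orth ε'
    rw [minner_comm', minner_sub_left, minner_smul_left, h2]
    linarith
  · have hs : (hooke lam mu ε').IsSymm :=
      (hε.smul _).add (Matrix.isSymm_one.smul _)
    have h := projT _ hs
    have e : minner (hooke lam mu ε') g = (2 * mu) * minner ε' g := by
      rw [minner_comm', hooke, minner_add_right, minner_smul_right, minner_smul_right, hg1,
        minner_comm' g ε']
      ring
    have e2 : max 0 (minner (hooke lam mu ε') g) = (2 * mu) * max 0 (minner ε' g) := by
      rw [e, mul_max_of_nonneg _ _ (by positivity), mul_zero]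
    rw [e2] at h
    convert h using 1
    rw [hooke, smul_sub, smul_smul, mul_div_assoc]
    abel
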